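/- arXiv:math/9805034 — 2 statements merged into one kernel-verified Lean document; each statement's English description precedes it below -/
import Mathlib

section
/- Let m ≥ 2, L = sl(m|1), and let L₀ be the even part of L. The space of super-skew-symmetric bilinear forms f : L×L → 𝕂 (f(B,A) = −(−1)^{|A||B|} f(A,B) for homogeneous A,B) that are L₀-invariant, i.e. f(⟨C,A⟩,B) + f(A,⟨C,B⟩) = 0 for all C ∈ L₀ and all A,B ∈ L, is one-dimensional, spanned by the form (A,B) ↦ Tr(⟨A,B⟩), where Tr denotes the ordinary matrix trace. -/
open Matrix

variable (K : Type) [Field K]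

/-- The space of matrices underlying `gl(m|n)`. -/
abbrev gl (m n : ℕ) : Type := Matrix (Fin (m + n)) (Fin (m + n)) K

/-- The parity of an index: indices `< m` are even, the rest odd. -/
def par (m n : ℕ) (i : Fin (m + n)) : ZMod 2 := if (i : ℕ) < m then 0 else 1

/-- `A` is homogeneous of parity `p`. -/
def IsHom {m n : ℕ} (p : ZMod 2) (A : gl K m n) : Prop :=
  ∀ i j, A i j ≠ 0 → par m n i + par m n j = p

/-- The sign `(-1)^p` for `p : ZMod 2`. -/
def sg (p : ZMod 2) : K := if p = 0 then 1 else -1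

/-- The even (block-diagonal) part of a matrix. -/
def evenP {m n : ℕ} (A : gl K m n) : gl K m n :=
  Matrix.of fun i j => if par m n i = par m n j then A i j else 0

/-- The odd (block-off-diagonal) part of a matrix. -/
def oddP {m n : ℕ} (A : gl K m n) : gl K m n :=
  Matrix.of fun i j => if par m n i = par m n j then 0 else A i j

/-- The super bracket `⟨A,B⟩ = AB - (-1)^{|A||B|} BA` on homogeneous elements,
extended bilinearly to all of `gl(m|n)`. -/
def sbr {m n : ℕ} (A B : gl K m n) : gl K m n :=
  A * B - evenP K B * A - oddP K B * evenP K A + oddP K B * oddP K A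

/-- The supertrace `Str(A) = Tr(a) - Tr(d)`. -/
def str {m n : ℕ} (A : gl K m n) : K := ∑ i, sg K (par m n i) * A i i

/-- `sl(m|n)`, the subspace of supertraceless matrices, as a submodule of `gl(m|n)`. -/
def sl (m n : ℕ) : Submodule K (gl K m n) where
  carrier := {A | str K A = 0}
  add_mem' {A B} hA hB := by
    simp only [Set.mem_setOf_eq, str] at *
    simp [Matrix.add_apply, mul_add, Finset.sum_add_distrib, hA, hB]
  zero_mem' := by simp [str]
  smul_mem' c A hA := by
    simp only [Set.mem_setOf_eq, str] at *
    simp only [Matrix.smul_apply, smul_eq_mul, mul_left_comm, ← Finset.mul_sum, hA, mul_zero]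

section Superalgebra

variable {K} {m n : ℕ}

theorem isHom_zero_iff {C : gl K m n} :
    IsHom K 0 C ↔ ∀ i j, par m n i ≠ par m n j → C i j = 0 := by
  refine forall₂_congr fun i j => ?_
  rw [CharTwo.add_eq_zero]
  tauto

theorem evenP_eq_self {C : gl K m n} (hC : IsHom K 0 C) : evenP K C = C := by
  ext i j
  simp only [evenP, of_apply]
  split_ifs with h
  · rfl
  · exact (isHom_zero_iff.1 hC i j h).symm

theorem oddP_eq_zero {C : gl K m n} (hC : IsHom K 0 C) : oddP K C = 0 := by
  ext i j
  simp only [oddP, of_apply]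
  split_ifs with h
  · rfl
  · exact isHom_zero_iff.1 hC i j h

theorem evenP_add_oddP (A : gl K m n) : evenP K A + oddP K A = A := by
  ext i j
  simp only [evenP, oddP, Matrix.add_apply, of_apply]
  split_ifs <;> simp

theorem sbr_of_isHom_zero {C : gl K m n} (hC : IsHom K 0 C) (A : gl K m n) :
    sbr K C A = C * A - A * C := by
  rw [sbr, evenP_eq_self hC, oddP_eq_zero hC, mul_zero, add_zero, sub_sub, ← add_mul,
    evenP_add_oddP]

theorem trace_evenP_mul_oddP (A B : gl K m n) : trace (evenP K A * oddP K B) = 0 := by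
  simp only [trace, diag, mul_apply, evenP, oddP, of_apply]
  refine Finset.sum_eq_zero fun i _ => Finset.sum_eq_zero fun j _ => ?_
  by_cases h : par m n i = par m n j
  · simp [h]
  · simp [h]

/-- The trace of the super bracket only sees the odd parts. -/
theorem trace_sbr (A B : gl K m n) :
    trace (sbr K A B) = 2 * trace (oddP K A * oddP K B) := by
  have h1 : trace (A * B) = trace (evenP K B * A) + trace (oddP K B * A) := by
    rw [← trace_add, ← add_mul, evenP_add_oddP, trace_mul_comm]
  have h2 : trace (oddP K B * A) = trace (oddP K B * oddP K A) := by
    conv_lhs => rw [← evenP_add_oddP A, mul_add, trace_add, trace_mul_comm,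
      trace_evenP_mul_oddP, zero_add]
  have h3 : trace (oddP K B * evenP K A) = 0 := by
    rw [trace_mul_comm, trace_evenP_mul_oddP]
  rw [sbr, trace_add, trace_sub, trace_sub, h1, h2, h3, trace_mul_comm (oddP K A)]
  ring

theorem oddP_commutator {C : gl K m n} (hC : IsHom K 0 C) (A : gl K m n) :
    oddP K (C * A - A * C) = C * oddP K A - oddP K A * C := by
  rw [isHom_zero_iff] at hC
  ext i j
  simp only [oddP, of_apply, Matrix.sub_apply, mul_apply]
  rw [← Finset.sum_sub_distrib, ← Finset.sum_sub_distrib]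
  split_ifs with h
  · refine (Finset.sum_eq_zero fun k _ => ?_).symm
    by_cases hk : par m n i = par m n k
    · simp [← hk, h]
    · rw [hC i k hk, hC k j (by rw [← h]; exact Ne.symm hk)]
      simp
  · refine Finset.sum_congr rfl fun k _ => ?_
    congr 1
    · by_cases hk : par m n i = par m n k
      · simp [← hk, h]
      · simp [hC i k hk]
    · by_cases hk : par m n k = par m n j
      · simp [hk, h]
      · simp [hC k j hk]

theorem str_commutator {C : gl K m n} (hC : IsHom K 0 C) (A : gl K m n) :
    str K (C * A - A * C) = 0 := by
  rw [isHom_zero_iff] at hC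
  simp only [str, Matrix.sub_apply, mul_apply, mul_sub, Finset.sum_sub_distrib, Finset.mul_sum]
  rw [sub_eq_zero, Finset.sum_comm]
  refine Finset.sum_congr rfl fun i _ => Finset.sum_congr rfl fun k _ => ?_
  by_cases hk : par m n k = par m n i
  · rw [hk]; ring
  · simp [hC k i hk]

theorem isHom_single (a b : Fin (m + n)) :
    IsHom K (par m n a + par m n b) (single a b (1 : K)) := by
  intro i j h
  rw [single_apply] at h
  split_ifs at h with hij
  · rw [hij.1, hij.2]
  · exact absurd rfl h

theorem oddP_single (a b : Fin (m + n)) : oddP K (single a b 1 : gl K m n) =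
    if par m n a = par m n b then 0 else single a b 1 := by
  split_ifs with h
  · refine oddP_eq_zero ?_
    have := isHom_single (K := K) a b
    rwa [h, CharTwo.add_self_eq_zero] at this
  · ext i j
    simp only [oddP, of_apply, single_apply]
    split_ifs with h1 h2 h2
    · exact absurd (by rw [h2.1, h2.2, h1]) h
    all_goals rfl

/-- The odd part as a linear map. -/
def oddPₗ (K : Type) [Field K] {m n : ℕ} : gl K m n →ₗ[K] gl K m n where
  toFun := oddP K
  map_add' A B := by
    ext i j
    simp only [oddP, Matrix.add_apply, of_apply]
    split_ifs <;> simp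
  map_smul' c A := by
    ext i j
    simp [oddP]

theorem str_add (A B : gl K m n) : str K (A + B) = str K A + str K B := by
  simp [str, mul_add, Finset.sum_add_distrib]

theorem str_smul (c : K) (A : gl K m n) : str K (c • A) = c * str K A := by
  simp only [str, Matrix.smul_apply, smul_eq_mul, mul_left_comm, ← Finset.mul_sum]

theorem str_single (a b : Fin (m + n)) (c : K) :
    str K (single a b c) = if a = b then sg K (par m n a) * c else 0 := by
  simp only [str, single_apply]
  split_ifs with h
  · subst h
    simp
  · refine Finset.sum_eq_zero fun i _ => ?_
    rw [if_neg (fun hi => h (hi.1.trans hi.2.symm)), mul_zero]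

theorem par_last : par m 1 (Fin.last m) = 1 := by simp [par]

theorem par_of_ne_last {a : Fin (m + 1)} (ha : a ≠ Fin.last m) : par m 1 a = 0 := by
  have := Fin.val_lt_last ha
  simp [par, this]

theorem str_one : str K (1 : gl K m 1) = m - 1 := by
  have h (i : Fin m) : par m 1 (Fin.castSucc i) = 0 := by simp [par]
  rw [str, Fin.sum_univ_castSucc]
  simp [h, par_last, sg, sub_eq_add_neg]

/-- The projection of `gl(m|1)` onto `sl(m|1)` along the last diagonal matrix unit. -/
def slProj (K : Type) [Field K] (m : ℕ) : gl K m 1 →ₗ[K] sl K m 1 where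
  toFun A := ⟨A + str K A • single (Fin.last m) (Fin.last m) 1, by
    change str K _ = 0
    rw [str_add, str_smul, str_single, par_last]
    simp [sg]⟩
  map_add' A B := by
    ext1
    simp only [str_add, add_smul, Submodule.coe_add]
    abel
  map_smul' c A := by
    ext1
    simp only [str_smul, mul_smul, RingHom.id_apply, Submodule.coe_smul, smul_add]

theorem coe_slProj (A : gl K m 1) :
    (slProj K m A : gl K m 1) = A + str K A • single (Fin.last m) (Fin.last m) 1 := rfl

theorem slProj_coe (A : sl K m 1) : slProj K m (A : gl K m 1) = A := by
  have : str K (A : gl K m 1) = 0 := A.2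
  ext1
  rw [coe_slProj, this, zero_smul, add_zero]

theorem slProj_single_last :
    slProj K m (single (Fin.last m) (Fin.last m) 1) = 0 := by
  ext1
  rw [coe_slProj, str_single, par_last]
  simp [sg]

theorem IsHom.slProj {p : ZMod 2} {A : gl K m 1} (hA : IsHom K p A) :
    IsHom K p (slProj K m A : gl K m 1) := by
  have h0 (h : p ≠ 0) : str K A = 0 := by
    refine Finset.sum_eq_zero fun i _ => ?_
    by_contra hi
    exact h (by rw [← hA i i (right_ne_zero_of_mul hi), CharTwo.add_self_eq_zero])
  rw [coe_slProj]
  by_cases hp : p = 0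
  · subst hp
    intro i j hij
    by_contra hne
    apply hij
    rw [Matrix.add_apply, Matrix.smul_apply, by_contra fun h => hne (hA i j h), single_apply, if_neg, smul_zero,
      add_zero]
    rintro ⟨rfl, rfl⟩
    exact hne (CharTwo.add_self_eq_zero _)
  · rwa [h0 hp, zero_smul, add_zero]

end Superalgebra

section InvariantForms

variable {K} {m : ℕ} {F : gl K m 1 →ₗ[K] gl K m 1 →ₗ[K] K}

/-- Invariance of a form on `gl(m|1)` under the even part of `gl(m|1)`. -/
def IsEvenInvariant (F : gl K m 1 →ₗ[K] gl K m 1 →ₗ[K] K) : Prop :=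
  ∀ C : gl K m 1, IsHom K 0 C → ∀ A B, F (C * A - A * C) B + F A (C * B - B * C) = 0

/-- Super-skew-symmetry of a form on `gl(m|1)`. -/
def IsSuperSkew (F : gl K m 1 →ₗ[K] gl K m 1 →ₗ[K] K) : Prop :=
  ∀ (pA pB : ZMod 2) (A B : gl K m 1), IsHom K pA A → IsHom K pB B →
    F B A = -(sg K (pA * pB) * F A B)

theorem IsEvenInvariant.single_left (hF : IsEvenInvariant F) {a b : Fin (m + 1)}
    (hab : par m 1 a = par m 1 b) (A B : gl K m 1) :
    F (single a b 1 * A - A * single a b 1) B + F A (single a b 1 * B - B * single a b 1) = 0 := by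
  refine hF _ ?_ A B
  have := isHom_single (K := K) a b
  rwa [hab, CharTwo.add_self_eq_zero] at this

theorem commutator_single_diag (p a b : Fin (m + 1)) :
    (single p p 1 * single a b 1 - single a b 1 * single p p 1 : gl K m 1) =
      ((if p = a then 1 else 0) - (if p = b then 1 else 0) : K) • single a b 1 := by
  rw [sub_smul]
  congr 1
  · split_ifs with h
    · subst h; simp
    · rw [single_mul_single_of_ne _ _ _ _ h, zero_smul]
  · split_ifs with h
    · subst h; simp
    · rw [single_mul_single_of_ne _ _ _ _ (Ne.symm h), zero_smul]

/-- Weight considerations for the diagonal torus. -/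
theorem IsEvenInvariant.apply_single_eq_zero [CharZero K] (hF : IsEvenInvariant F)
    {a b c d : Fin (m + 1)} (h1 : ¬(a = b ∧ c = d)) (h2 : ¬(a = d ∧ b = c)) :
    F (single a b 1) (single c d 1) = 0 := by
  by_contra hne
  have key (p : Fin (m + 1)) : ((if p = a then 1 else 0) - (if p = b then 1 else 0) +
      ((if p = c then 1 else 0) - (if p = d then 1 else 0)) : K) = 0 := by
    have := hF.single_left (a := p) rfl (single a b 1) (single c d 1)
    rw [commutator_single_diag, commutator_single_diag, map_smul, map_smul, LinearMap.smul_apply,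
      smul_eq_mul, smul_eq_mul, ← add_mul] at this
    exact (mul_eq_zero.1 this).resolve_right hne
  have hc := key c
  by_cases hab : a = b
  · subst hab
    by_cases hcd : c = d
    · exact h1 ⟨rfl, hcd⟩
    · simp [hcd] at hc
  · by_cases had : a = d
    · subst had
      by_cases hcb : c = b
      · exact h2 ⟨rfl, hcb.symm⟩
      · simp [hcb] at hc
    · have ha := key a
      simp only [hab, had, if_true, if_false, sub_zero] at ha
      split_ifs at ha <;> norm_num at ha

theorem IsSuperSkew.apply_even (hS : IsSuperSkew F) {a b c d : Fin (m + 1)}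
    (hab : par m 1 a = par m 1 b) :
    F (single c d 1) (single a b 1) = -F (single a b 1) (single c d 1) := by
  rw [hS _ _ _ _ (isHom_single a b) (isHom_single c d), hab, CharTwo.add_self_eq_zero]
  simp [sg]

theorem IsSuperSkew.apply_even_self [CharZero K] (hS : IsSuperSkew F) {a b : Fin (m + 1)}
    (hab : par m 1 a = par m 1 b) : F (single a b 1) (single a b 1) = 0 :=
  self_eq_neg.1 (hS.apply_even hab)

theorem IsSuperSkew.apply_diag_eq_zero [CharZero K] (hS : IsSuperSkew F) (hF : IsEvenInvariant F)
    {a b : Fin (m + 1)} (h : par m 1 a = par m 1 b) (hab : a ≠ b) :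
    F (single a a 1) (single b b 1) = 0 ∧ F (single a b 1) (single b a 1) = 0 := by
  have h1 := hF.single_left h (single b a 1) (single b b 1)
  have h2 := hF.single_left h (single b a 1) (single a a 1)
  simp only [single_mul_single_same, single_mul_single_of_ne _ _ _ _ hab.symm, mul_one, sub_zero, zero_sub, map_sub, map_neg,
    LinearMap.sub_apply, hS.apply_even_self rfl] at h1 h2
  have h3 := hS.apply_even (a := a) (b := a) (c := b) (d := b) rfl
  have h4 := hS.apply_even (c := b) (d := a) h
  rw [h4] at h1 h2
  rw [h3] at h2
  have h5 : F (single a a 1) (single b b 1) = 0 := by linear_combination (h1 + h2) / 2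
  exact ⟨h5, by linear_combination h5 - h1⟩

/-- A super-skew-symmetric even-invariant form on `gl(m|1)` killing the last diagonal matrix unit
is a multiple of the trace of the super bracket. -/
theorem IsSuperSkew.eq_smul_trace_sbr [CharZero K] (hm : 1 ≤ m) (hS : IsSuperSkew F)
    (hF : IsEvenInvariant F)
    (hl : F (single (Fin.last m) (Fin.last m) 1) = 0) :
    ∃ c : K, ∀ A B, F A B = c * trace (sbr K A B) := by
  have hl' (a : Fin (m + 1)) :
      F (single a a 1) (single (Fin.last m) (Fin.last m) 1) = 0 := by
    rw [hS.apply_even rfl, hl, LinearMap.zero_apply, neg_zero]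
  have hdiag (a b : Fin (m + 1)) : F (single a a 1) (single b b 1) = 0 := by
    by_cases hab : a = b
    · rw [hab]
      exact hS.apply_even_self rfl
    by_cases ha : a = Fin.last m
    · rw [ha, hl, LinearMap.zero_apply]
    by_cases hb : b = Fin.last m
    · rw [hb, hl']
    exact (hS.apply_diag_eq_zero hF (by rw [par_of_ne_last ha, par_of_ne_last hb]) hab).1
  have hodd (a b : Fin (m + 1)) (ha : a ≠ Fin.last m) (hb : b ≠ Fin.last m) :
      F (single a (Fin.last m) 1) (single (Fin.last m) a 1) =
        F (single b (Fin.last m) 1) (single (Fin.last m) b 1) := by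
    have h := hF.single_left (a := a) (b := b) (by rw [par_of_ne_last ha, par_of_ne_last hb])
      (single b (Fin.last m) 1) (single (Fin.last m) a 1)
    simp only [single_mul_single_same, single_mul_single_of_ne _ _ _ _ hb,
      single_mul_single_of_ne _ _ _ _ ha.symm, mul_one, sub_zero, zero_sub, map_neg] at h
    linear_combination h
  have hsymm (a : Fin (m + 1)) (ha : a ≠ Fin.last m) :
      F (single (Fin.last m) a 1) (single a (Fin.last m) 1) =
        F (single a (Fin.last m) 1) (single (Fin.last m) a 1) := by
    rw [hS _ _ _ _ (isHom_single a (Fin.last m)) (isHom_single (Fin.last m) a),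
      par_of_ne_last ha, par_last]
    simp [sg]
  let z : Fin (m + 1) := ⟨0, by omega⟩
  have hz : z ≠ Fin.last m := by
    intro h
    have := congrArg Fin.val h
    simp [z] at this
    omega
  refine ⟨F (single z (Fin.last m) 1) (single (Fin.last m) z 1) / 2, ?_⟩
  have hbasis (a b c d : Fin (m + 1)) : F (single a b 1) (single c d 1) =
      F (single z (Fin.last m) 1) (single (Fin.last m) z 1) *
        trace (oddP K (single a b 1 : gl K m 1) * oddP K (single c d 1 : gl K m 1)) := by
    rw [oddP_single, oddP_single]
    by_cases h1 : a = b ∧ c = d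
    · obtain ⟨rfl, rfl⟩ := h1
      simp [hdiag]
    by_cases h2 : a = d ∧ b = c
    · obtain ⟨rfl, rfl⟩ := h2
      have hab : a ≠ b := fun h => h1 ⟨h, h.symm⟩
      by_cases ha : a = Fin.last m
      · subst ha
        rw [if_neg, if_neg, hsymm b hab.symm, hodd b z hab.symm hz]
        · simp
        all_goals rw [par_last, par_of_ne_last hab.symm]; simp
      by_cases hb : b = Fin.last m
      · subst hb
        rw [if_neg, if_neg, hodd a z hab hz]
        · simp
        all_goals rw [par_last, par_of_ne_last hab]; simp
      have h : par m 1 a = par m 1 b := by rw [par_of_ne_last ha, par_of_ne_last hb]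
      rw [(hS.apply_diag_eq_zero hF h hab).2, if_pos h]
      simp
    · rw [hF.apply_single_eq_zero h1 h2]
      split_ifs <;> try simp
      by_cases hbc : b = c
      · subst hbc
        rw [single_mul_single_same, trace_single_eq_of_ne _ _ _ fun h => h2 ⟨h, rfl⟩]
        simp
      · rw [single_mul_single_of_ne _ _ _ _ hbc]
        simp
  intro A B
  rw [trace_sbr, ← mul_assoc, div_mul_cancel₀ _ two_ne_zero]
  suffices h : F = F (single z (Fin.last m) 1) (single (Fin.last m) z 1) •
      ((LinearMap.mul K (gl K m 1)).compr₂ (traceLinearMap _ K K)).compl₁₂ (oddPₗ K) (oddPₗ K) from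
    LinearMap.congr_fun₂ h A B
  refine ext_linearMap K fun a b => LinearMap.ext_ring <| ext_linearMap K fun c d =>
    LinearMap.ext_ring ?_
  exact hbasis a b c d

end InvariantForms

/-- Let `m ≥ 2`, `L = sl(m|1)` and let `L₀` be the even part of `L`.
The space of super-skew-symmetric `L₀`-invariant bilinear forms `f : L × L → 𝕂` is
one-dimensional, spanned by the form `(A,B) ↦ Tr(⟨A,B⟩)` (ordinary matrix trace). -/
theorem invariant_skew_forms_one_dimensional
    (K : Type) [Field K] [IsAlgClosed K] [CharZero K] (m : ℕ) (hm : 2 ≤ m) :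
    -- the trace form is super-skew-symmetric ...
    (∀ (pA pB : ZMod 2) (A B : gl K m 1), IsHom K pA A → IsHom K pB B →
      Matrix.trace (sbr K B A) = -(sg K (pA * pB) * Matrix.trace (sbr K A B))) ∧
    -- ... and `L₀`-invariant ...
    (∀ C ∈ sl K m 1, IsHom K 0 C → ∀ A ∈ sl K m 1, ∀ B ∈ sl K m 1,
      Matrix.trace (sbr K (sbr K C A) B) + Matrix.trace (sbr K A (sbr K C B)) = 0) ∧
    -- ... and non-zero on `L × L`, ...
    (∃ A B : ↥(sl K m 1), Matrix.trace (sbr K (A : gl K m 1) (B : gl K m 1)) ≠ 0) ∧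
    -- ... and every super-skew-symmetric `L₀`-invariant bilinear form on `L` is a scalar
    -- multiple of it.
    (∀ f : ↥(sl K m 1) →ₗ[K] ↥(sl K m 1) →ₗ[K] K,
      (∀ (pA pB : ZMod 2) (A B : ↥(sl K m 1)),
        IsHom K pA (A : gl K m 1) → IsHom K pB (B : gl K m 1) →
        f B A = -(sg K (pA * pB) * f A B)) →
      (∀ (C : ↥(sl K m 1)), IsHom K 0 (C : gl K m 1) →
        ∀ (A B CA CB : ↥(sl K m 1)),
          (CA : gl K m 1) = sbr K ↑C ↑A → (CB : gl K m 1) = sbr K ↑C ↑B →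
          f CA B + f A CB = 0) →
      ∃ c : K, ∀ A B : ↥(sl K m 1),
        f A B = c * Matrix.trace (sbr K (A : gl K m 1) (B : gl K m 1))) := by
  refine ⟨fun pA pB A B hA hB => ?_, fun C _ hC A _ B _ => ?_, ?_, fun f hskew hinv => ?_⟩
  · rw [trace_sbr, trace_sbr, trace_mul_comm]
    have h01 (p : ZMod 2) : p = 0 ∨ p = 1 := by revert p; decide
    rcases h01 pA with rfl | rfl
    · simp [oddP_eq_zero hA]
    rcases h01 pB with rfl | rfl
    · simp [oddP_eq_zero hB]
    simp [sg]
  · rw [sbr_of_isHom_zero hC, sbr_of_isHom_zero hC, trace_sbr, trace_sbr, oddP_commutator hC,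
      oddP_commutator hC, sub_mul, mul_sub, trace_sub, trace_sub, mul_assoc C, trace_mul_comm C,
      mul_assoc, mul_assoc]
    ring
  · let z : Fin (m + 1) := ⟨0, by omega⟩
    have hz : z ≠ Fin.last m := by
      intro h
      have := congrArg Fin.val h
      simp [z] at this
      omega
    refine ⟨⟨single z (Fin.last m) 1, ?_⟩, ⟨single (Fin.last m) z 1, ?_⟩, ?_⟩
    · change str K _ = 0
      rw [str_single, if_neg hz]
    · change str K _ = 0
      rw [str_single, if_neg hz.symm]
    · have h : par m 1 z ≠ par m 1 (Fin.last m) := by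
        rw [par_of_ne_last hz, par_last]
        simp
      rw [trace_sbr, oddP_single, oddP_single, if_neg h, if_neg h.symm]
      simp
  · let F : gl K m 1 →ₗ[K] gl K m 1 →ₗ[K] K := f.compl₁₂ (slProj K m) (slProj K m)
    have hS : IsSuperSkew F := fun pA pB A B hA hB => hskew pA pB _ _ hA.slProj hB.slProj
    have hF : IsEvenInvariant F := by
      intro C hC A B
      have hm1 : (m : K) - 1 ≠ 0 := by
        rw [sub_ne_zero]
        exact_mod_cast (by omega : m ≠ 1)
      let C' : gl K m 1 := C - (str K C / (m - 1)) • 1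
      have hstr : str K C' = 0 := by
        change str K (C - _) = 0
        rw [sub_eq_add_neg, ← neg_smul, str_add, str_smul, str_one]
        field_simp
        ring
      have hC' : IsHom K 0 C' := by
        rw [isHom_zero_iff] at hC ⊢
        intro i j hij
        have : i ≠ j := fun h => hij (by rw [h])
        simp [C', hC i j hij, this]
      have hbr (A : gl K m 1) :
          (slProj K m (C * A - A * C) : gl K m 1) = sbr K C' (slProj K m A) := by
        rw [coe_slProj, str_commutator hC, sbr_of_isHom_zero hC', coe_slProj, zero_smul, add_zero]
        have hcomm : C * single (Fin.last m) (Fin.last m) 1 =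
            single (Fin.last m) (Fin.last m) 1 * C := by
          rw [isHom_zero_iff] at hC
          ext i j
          have hl (k : Fin (m + 1)) (hk : k ≠ Fin.last m) :
              C k (Fin.last m) = 0 ∧ C (Fin.last m) k = 0 := by
            constructor <;> apply hC <;> rw [par_of_ne_last hk, par_last] <;> simp
          by_cases hi : i = Fin.last m <;> by_cases hj : j = Fin.last m
          · subst hi; subst hj; simp
          · subst hi; simp [hj, hl]
          · subst hj; simp [hi, hl]
          · simp [hi, hj]
        simp only [C', sub_mul, mul_sub, mul_add, add_mul, smul_mul_assoc, mul_smul_comm, one_mul,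
          mul_one, hcomm]
        module
      exact hinv ⟨C', hstr⟩ hC' _ _ _ _ (hbr A) (hbr B)
    have hl : F (single (Fin.last m) (Fin.last m) 1) = 0 := by
      ext1 B
      simp only [F, LinearMap.compl₁₂_apply, slProj_single_last, map_zero, LinearMap.zero_apply]
    obtain ⟨c, hc⟩ := hS.eq_smul_trace_sbr (by omega) hF hl
    refine ⟨c, fun A B => ?_⟩
    rw [← hc, LinearMap.compl₁₂_apply, slProj_coe, slProj_coe]
end

section
/- Let m ≥ 2. The space of bilinear maps B : M_m(𝕂) × 𝕂^m → 𝕂^m satisfying the sl(m,𝕂)-equivariance condition B([A,X], v) + B(X, Av) = A·B(X,v) for every trace-zero m×m matrix A, every X ∈ M_m(𝕂) and every v ∈ 𝕂^m (where [A,X] = AX − XA), is two-dimensional, spanned by the maps (X,v) ↦ Xv and (X,v) ↦ Tr(X)·v. -/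
/-- A four-index array with values in a field satisfying the relations that express
`gl(m)`-invariance is a combination of the two products of Kronecker deltas. -/
lemma exists_eq_deltas_of_invariant {K : Type*} [Field K] [CharZero K] {m : ℕ} (hm : 2 ≤ m)
    (b : Fin m → Fin m → Fin m → Fin m → K)
    (h : ∀ p q i j k l, (if q = i then b p j k l else 0) - (if j = p then b i q k l else 0)
      + (if q = k then b i j p l else 0) = if p = l then b i j k q else 0) :
    ∃ c d : K, ∀ i j k l, b i j k l =
      c * (if j = k then if i = l then 1 else 0 else 0)
        + d * (if i = j then if k = l then 1 else 0 else 0) := by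
  have hT (p q k l) : (if q = k then ∑ i, b i i p l else 0) =
      if p = l then ∑ i, b i i k q else 0 := by
    have := Finset.sum_congr (rfl : Finset.univ = Finset.univ) fun i _ => h p q i i k l
    simp only [Finset.sum_add_distrib, Finset.sum_sub_distrib, Finset.sum_ite_eq,
      Finset.sum_ite_eq', Finset.mem_univ, if_true, sub_self, zero_add] at this
    split_ifs at this ⊢ <;> simp_all
  have hS (p q j k) : (if j = p then ∑ i, b i q k i else 0) =
      if q = k then ∑ i, b i j p i else 0 := by
    have := Finset.sum_congr (rfl : Finset.univ = Finset.univ) fun i _ => h p q i j k i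
    simp only [Finset.sum_add_distrib, Finset.sum_sub_distrib, Finset.sum_ite_eq,
      Finset.mem_univ, if_true] at this
    have e : ∑ i, (if j = p then b i q k i else 0) = if j = p then ∑ i, b i q k i else 0 := by
      split_ifs <;> simp
    have e' : ∑ i, (if q = k then b i j p i else 0) = if q = k then ∑ i, b i j p i else 0 := by
      split_ifs <;> simp
    rw [e, e'] at this
    linear_combination -this
  let o : Fin m := ⟨0, by omega⟩
  obtain ⟨t, ht⟩ : ∃ t : K, ∀ k l, ∑ i, b i i k l = if k = l then t else 0 :=
    ⟨∑ i, b i i o o, fun k l => by simpa using hT k o o l⟩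
  obtain ⟨s, hs⟩ : ∃ s : K, ∀ j k, ∑ i, b i j k i = if j = k then s else 0 :=
    ⟨∑ i, b i o o i, fun j k => by simpa using hS o j o k⟩
  have key (p j k l) : m * b p j k l + b k j p l =
      (if j = p then if k = l then t else 0 else 0)
        + if p = l then if j = k then s else 0 else 0 := by
    have := Finset.sum_congr (rfl : Finset.univ = Finset.univ) fun i _ => h p i i j k l
    have e1 : ∑ i, (if j = p then b i i k l else 0) = if j = p then ∑ i, b i i k l else 0 := by
      split_ifs <;> simp
    have e2 : ∑ i, (if p = l then b i j k i else 0) = if p = l then ∑ i, b i j k i else 0 := by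
      split_ifs <;> simp
    simp only [Finset.sum_add_distrib, Finset.sum_sub_distrib, e1, e2, ht, hs,
      Finset.sum_ite_eq', Finset.mem_univ, if_true, Finset.sum_const, Finset.card_univ,
      Fintype.card_fin, nsmul_eq_mul] at this
    linear_combination this
  have hm0 : (m : K) ^ 2 - 1 ≠ 0 := by
    rw [sub_ne_zero]
    have : m ^ 2 ≠ 1 := by nlinarith
    exact_mod_cast this
  refine ⟨(m * s - t) / (m ^ 2 - 1), (m * t - s) / (m ^ 2 - 1), fun i j k l => ?_⟩
  have h1 := key i j k l
  have h2 := key k j i l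
  field_simp
  simp only [eq_comm (a := i) (b := j)]
  split_ifs at h1 h2 ⊢ <;> linear_combination m * h1 - h2

open Matrix in
/-- A bilinear map equivariant under trace-zero matrices is equivariant under all matrices. -/
lemma equivariant_of_trace_zero_equivariant {K : Type*} [Field K] [CharZero K] {m : ℕ}
    (hm : m ≠ 0) (B : Matrix (Fin m) (Fin m) K →ₗ[K] (Fin m → K) →ₗ[K] (Fin m → K))
    (hB : ∀ A : Matrix (Fin m) (Fin m) K, A.trace = 0 →
      ∀ X v, B (A * X - X * A) v + B X (A *ᵥ v) = A *ᵥ (B X v))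
    (A X : Matrix (Fin m) (Fin m) K) (v : Fin m → K) :
    B (A * X - X * A) v + B X (A *ᵥ v) = A *ᵥ (B X v) := by
  have hm' : (m : K) ≠ 0 := Nat.cast_ne_zero.mpr hm
  have := hB (A - (A.trace / m) • 1) (by simp [trace_sub, trace_smul, hm']) X v
  simpa [sub_mul, mul_sub, sub_mulVec, smul_mulVec, ← sub_eq_add_neg, ← add_sub_assoc] using this

/-- Let `m ≥ 2`.  The space of bilinear maps `B : M_m(𝕂) × 𝕂^m → 𝕂^m`
which are `sl(m,𝕂)`-equivariant (with `sl(m,𝕂)` acting on `M_m(𝕂)` by the commutator and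
on `𝕂^m` by matrix–vector multiplication) is two-dimensional, spanned by `(X,v) ↦ Xv`
and `(X,v) ↦ Tr(X)·v`. -/
theorem equivariant_maps_matrix_vector_two_dimensional
    (K : Type) [Field K] [IsAlgClosed K] [CharZero K] (m : ℕ) (hm : 2 ≤ m) :
    -- `(X,v) ↦ Xv` is equivariant ...
    (∀ A : Matrix (Fin m) (Fin m) K, A.trace = 0 →
      ∀ (X : Matrix (Fin m) (Fin m) K) (v : Fin m → K),
        (A * X - X * A).mulVec v + X.mulVec (A.mulVec v) = A.mulVec (X.mulVec v)) ∧
    -- ... `(X,v) ↦ Tr(X)·v` is equivariant ...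
    (∀ A : Matrix (Fin m) (Fin m) K, A.trace = 0 →
      ∀ (X : Matrix (Fin m) (Fin m) K) (v : Fin m → K),
        (A * X - X * A).trace • v + X.trace • A.mulVec v = A.mulVec (X.trace • v)) ∧
    -- ... the two maps are linearly independent ...
    (∀ c d : K, (∀ (X : Matrix (Fin m) (Fin m) K) (v : Fin m → K),
        c • X.mulVec v + d • X.trace • v = 0) → c = 0 ∧ d = 0) ∧
    -- ... and they span the space of equivariant bilinear maps.
    (∀ B : Matrix (Fin m) (Fin m) K →ₗ[K] (Fin m → K) →ₗ[K] (Fin m → K),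
      (∀ A : Matrix (Fin m) (Fin m) K, A.trace = 0 →
        ∀ (X : Matrix (Fin m) (Fin m) K) (v : Fin m → K),
          B (A * X - X * A) v + B X (A.mulVec v) = A.mulVec (B X v)) →
      ∃ c d : K, ∀ (X : Matrix (Fin m) (Fin m) K) (v : Fin m → K),
        B X v = c • X.mulVec v + d • X.trace • v) := by
  refine ⟨fun A _ X v => ?_, fun A _ X v => ?_, fun c d h => ?_, fun B hB => ?_⟩
  · simp [Matrix.sub_mulVec]
  · simp [Matrix.trace_sub, Matrix.trace_mul_comm A X, Matrix.mulVec_smul]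
  · let o : Fin m := ⟨0, by omega⟩
    let u : Fin m := ⟨1, by omega⟩
    have hou : o ≠ u := by simp [o, u]
    have h1 := congrFun (h (Matrix.single o u 1) (Pi.single u 1)) o
    have h2 := congrFun (h (Matrix.single o o 1) (Pi.single u 1)) u
    simp [hou] at h1
    simp [hou] at h2
    exact ⟨h1, h2⟩
  · have hgl := equivariant_of_trace_zero_equivariant (by omega) B hB
    obtain ⟨c, d, hcd⟩ := exists_eq_deltas_of_invariant hm
      (fun i j k l => B (Matrix.single i j 1) (Pi.single k 1) l) fun p q i j k l => by
        have := congrFun (hgl (Matrix.single p q 1) (Matrix.single i j 1) (Pi.single k 1)) l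
        have e (a b c d : Fin m) : Matrix.single a b (1 : K) * Matrix.single c d 1 =
            if b = c then Matrix.single a d 1 else 0 := by
          split_ifs with hbc
          · simp [hbc]
          · exact Matrix.single_mul_single_of_ne _ _ _ _ hbc _
        rw [e, e, Matrix.single_mulVec_eq, Matrix.single_mulVec_eq] at this
        simp only [map_sub, LinearMap.sub_apply, Pi.add_apply, Pi.sub_apply, map_smul,
          Pi.smul_apply, Pi.single_apply, one_mul, smul_eq_mul, eq_comm (a := l), mul_ite,
          mul_one, mul_zero, ite_mul, zero_mul] at this
        rw [← this]
        split_ifs <;> simp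
    refine ⟨c, d, fun X v => ?_⟩
    have : B = c • Matrix.mulVecBilin K K
        + d • (Matrix.traceLinearMap (Fin m) K K).smulRight LinearMap.id := by
      refine Matrix.ext_linearMap _ fun i j => ?_
      ext k l
      simp [hcd, Matrix.trace, Matrix.single_apply, ite_and, eq_comm (a := j)]
      split_ifs <;> simp_all
    simp [this]
end
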